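/- Let k ≥ 1 and let v_1, …, v_k ∈ ℚ² be vectors each having both coordinates positive, and pairwise non-proportional (for i ≠ j there is no c ∈ ℚ with v_i = c·v_j). Let L be the k×k matrix over ℚ with entries L_{ij} := max(v_{j1}/v_{i1}, v_{j2}/v_{i2}), where v_i = (v_{i1}, v_{i2}). Then L is invertible, i.e., det L ≠ 0. -/

import Mathlib

/-- The matrix with entries `max (t i) (t j)`, for distinct positive `t i`, has trivial kernel. -/
theorem eq_zero_of_sum_max_mul_eq_zero {ι K : Type*} [Fintype ι] [Field K] [LinearOrder K]
    [IsStrictOrderedRing K] {t c : ι → K} (ht : ∀ i, 0 < t i) (hinj : Function.Injective t)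
    (h : ∀ i, ∑ j, max (t i) (t j) * c j = 0) : c = 0 := by
  classical
  by_contra hc
  set S := Finset.univ.filter fun i => c i ≠ 0 with hS
  have hsum (i : ι) : ∑ j ∈ S, max (t i) (t j) * c j = 0 := by
    rw [← h i]
    refine Finset.sum_subset (Finset.subset_univ _) fun j _ hj => ?_
    have : c j = 0 := by simpa [hS] using hj
    simp [this]
  have hne : S.Nonempty := by
    obtain ⟨i, hi⟩ := Function.ne_iff.mp hc
    exact ⟨i, by simpa [hS] using hi⟩
  obtain ⟨m, hm, hmin⟩ := S.exists_min_image t hne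
  have hcm : c m ≠ 0 := by simpa [hS] using hm
  have hrow := hsum m
  rw [← Finset.add_sum_erase S _ hm, max_self] at hrow
  rcases (S.erase m).eq_empty_or_nonempty with he | hne'
  · rw [he, Finset.sum_empty, add_zero] at hrow
    exact (mul_ne_zero (ht m).ne' hcm) hrow
  · obtain ⟨m', hm', hmin'⟩ := (S.erase m).exists_min_image t hne'
    obtain ⟨hne_mm', hm'S⟩ := Finset.mem_erase.mp hm'
    have hrow' := hsum m'
    rw [← Finset.add_sum_erase S _ hm, max_eq_left (hmin m' hm'S)] at hrow'
    have heq : ∑ j ∈ S.erase m, max (t m') (t j) * c j =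
        ∑ j ∈ S.erase m, max (t m) (t j) * c j :=
      Finset.sum_congr rfl fun j hj => by
        rw [max_eq_right (hmin' j hj), max_eq_right (hmin j (Finset.mem_of_mem_erase hj))]
    have hmul : (t m' - t m) * c m = 0 := by linear_combination hrow' - hrow - heq
    exact mul_ne_zero (sub_ne_zero.mpr (hinj.ne hne_mm')) hcm hmul

/-- for pairwise non-proportional vectors `v 1, …, v k ∈ ℚ²` with positive
coordinates, the `k × k` matrix with entries `L i j = max (v_{j1}/v_{i1}) (v_{j2}/v_{i2})`
is invertible. -/
theorem linking_matrix_det_ne_zero (k : ℕ) (hk : 1 ≤ k) (v : Fin k → ℚ × ℚ)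
    (hpos : ∀ i, 0 < (v i).1 ∧ 0 < (v i).2)
    (hprop : ∀ i j, i ≠ j → ¬ ∃ c : ℚ, v i = c • v j) :
    (Matrix.of fun i j : Fin k =>
      max ((v j).1 / (v i).1) ((v j).2 / (v i).2)).det ≠ 0 := by
  intro hdet
  obtain ⟨x, hx, hLx⟩ := Matrix.exists_mulVec_eq_zero_iff.mpr hdet
  have ha (i : Fin k) : (v i).1 ≠ 0 := (hpos i).1.ne'
  have hb (i : Fin k) : (v i).2 ≠ 0 := (hpos i).2.ne'
  have hinj : Function.Injective fun i => (v i).2 / (v i).1 := by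
    intro i j hij
    by_contra hne
    refine hprop i j hne ⟨(v i).1 / (v j).1, Prod.ext ?_ ?_⟩
    · simp [ha j]
    · have hcross := (div_eq_div_iff (ha i) (ha j)).mp hij
      simp only [Prod.smul_snd, smul_eq_mul]
      have := ha j
      field_simp
      linear_combination hcross
  have hentry (i j : Fin k) : max ((v i).2 / (v i).1) ((v j).2 / (v j).1) * (v j).1 =
      (v i).2 * max ((v j).1 / (v i).1) ((v j).2 / (v i).2) := by
    rw [max_mul_of_nonneg _ _ (hpos j).1.le, mul_max_of_nonneg _ _ (hpos i).2.le,
      div_mul_cancel₀ _ (ha j), mul_div_cancel₀ _ (hb i), div_mul_eq_mul_div, mul_div_assoc]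
  have hzero := eq_zero_of_sum_max_mul_eq_zero (c := fun j => (v j).1 * x j)
    (fun i => div_pos (hpos i).2 (hpos i).1) hinj fun i => by
      have hrow : ∑ j, max ((v j).1 / (v i).1) ((v j).2 / (v i).2) * x j = 0 := congrFun hLx i
      simp only [← mul_assoc, hentry]
      simp only [mul_assoc, ← Finset.mul_sum, hrow, mul_zero]
  refine hx (funext fun j => ?_)
  exact (mul_eq_zero.mp (congrFun hzero j)).resolve_left (ha j)
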